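/- If ρ̂(G, M) < 1/√n, then the system S(G, M) admits a quadratic Lyapunov multinorm, i.e. a quadratic γ-multinorm for some γ with 0 < γ < 1. -/

import Mathlib

open Filter Matrix

/-- The operator norm on `n × n` real matrices induced by the Euclidean norm on `ℝ^n`. -/
noncomputable def euclOpNorm {n : ℕ} (A : Matrix (Fin n) (Fin n) ℝ) : ℝ :=
  ‖LinearMap.toContinuousLinearMap (Matrix.toEuclideanLin A)‖

/-- The Euclidean norm on `ℝ^n`. -/
noncomputable def euclNorm {n : ℕ} (x : Fin n → ℝ) : ℝ :=
  Real.sqrt (∑ i, x i ^ 2)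

/-- The matrix product `A_{σ(t-1)} ⋯ A_{σ(0)}` associated to a sequence of labels `σ`. -/
noncomputable def pathProd {n N : ℕ} (A : Fin N → Matrix (Fin n) (Fin n) ℝ)
    (t : ℕ) (σ : Fin t → Fin N) : Matrix (Fin n) (Fin n) ℝ :=
  (List.ofFn fun i => A (σ i)).reverse.prod

/-- `v, σ` describe a path of length `t` in the labeled graph with edge set `E`:
its `i`-th edge goes from node `v i` to node `v (i+1)` and carries the label `σ i`. -/
def IsPath {V : Type*} {N : ℕ} (E : Set (V × V × Fin N)) {t : ℕ}
    (v : Fin (t + 1) → V) (σ : Fin t → Fin N) : Prop :=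
  ∀ i : Fin t, (v i.castSucc, v i.succ, σ i) ∈ E

/-- The labeled graph with edge set `E` is strongly connected: any node can be joined to
any node by a path of length at least 1. -/
def StronglyConnected {V : Type*} {N : ℕ} (E : Set (V × V × Fin N)) : Prop :=
  ∀ u w : V, ∃ (t : ℕ) (v : Fin (t + 1) → V) (σ : Fin t → Fin N),
    1 ≤ t ∧ IsPath E v σ ∧ v 0 = u ∧ v (Fin.last t) = w

/-- The constrained joint spectral radius of the system `S(G, M)` with `G = (V, E)`, `M = A`. -/
noncomputable def cjsr {V : Type*} {n N : ℕ} (E : Set (V × V × Fin N))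
    (A : Fin N → Matrix (Fin n) (Fin n) ℝ) : ℝ :=
  Filter.atTop.limsup fun t : ℕ =>
    sSup { x : ℝ | ∃ (v : Fin (t + 1) → V) (σ : Fin t → Fin N),
      IsPath E v σ ∧ x = euclOpNorm (pathProd A t σ) ^ (1 / (t : ℝ)) }

/-- The constrained joint spectral radius of the `T`-lifted system `S(G_T, M^T)`:
paths of length `k` in `G_T` are exactly paths of length `k * T` in `G`. -/
noncomputable def cjsrLift {V : Type*} {n N : ℕ} (E : Set (V × V × Fin N))
    (A : Fin N → Matrix (Fin n) (Fin n) ℝ) (T : ℕ) : ℝ :=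
  Filter.atTop.limsup fun k : ℕ =>
    sSup { x : ℝ | ∃ (v : Fin (k * T + 1) → V) (σ : Fin (k * T) → Fin N),
      IsPath E v σ ∧ x = euclOpNorm (pathProd A (k * T) σ) ^ (1 / (k : ℝ)) }

/-- Stability of the constrained switching system: along every infinite path of the graph,
every trajectory converges to `0`. -/
def Stable {V : Type*} {n N : ℕ} (E : Set (V × V × Fin N))
    (A : Fin N → Matrix (Fin n) (Fin n) ℝ) : Prop :=
  ∀ (v : ℕ → V) (σ : ℕ → Fin N), (∀ t : ℕ, (v t, v (t + 1), σ t) ∈ E) →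
    ∀ x0 : Fin n → ℝ,
      Tendsto (fun t : ℕ => (pathProd A t fun i : Fin t => σ i).mulVec x0)
        atTop (nhds 0)

/-- `ν` is a family of norms on `ℝ^n` indexed by the nodes. -/
def IsNormFamily {V : Type*} {n : ℕ} (ν : V → (Fin n → ℝ) → ℝ) : Prop :=
  ∀ u : V,
    (∀ x y : Fin n → ℝ, ν u (x + y) ≤ ν u x + ν u y) ∧
    (∀ (a : ℝ) (x : Fin n → ℝ), ν u (a • x) = |a| * ν u x) ∧
    (∀ x : Fin n → ℝ, ν u x = 0 → x = 0)

/-- `ν` is a `γ`-multinorm for the system `S(G, M)`. -/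
def IsMultinorm {V : Type*} {n N : ℕ} (E : Set (V × V × Fin N))
    (A : Fin N → Matrix (Fin n) (Fin n) ℝ) (γ : ℝ)
    (ν : V → (Fin n → ℝ) → ℝ) : Prop :=
  IsNormFamily ν ∧
    ∀ vi vj : V, ∀ σ : Fin N, (vi, vj, σ) ∈ E →
      ∀ x : Fin n → ℝ, ν vj ((A σ).mulVec x) ≤ γ * ν vi x

/-- `Q` is a quadratic `γ`-multinorm for the system `S(G, M)`. -/
def IsQuadMultinorm {V : Type*} {n N : ℕ} (E : Set (V × V × Fin N))
    (A : Fin N → Matrix (Fin n) (Fin n) ℝ) (γ : ℝ)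
    (Q : V → Matrix (Fin n) (Fin n) ℝ) : Prop :=
  (∀ u : V, (Q u).PosDef) ∧
    ∀ vi vj : V, ∀ σ : Fin N, (vi, vj, σ) ∈ E →
      (γ ^ 2 • Q vi - (A σ)ᵀ * Q vj * A σ).PosSemidef

/-- `Q` is a quadratic `γ`-multinorm for the lifted system `S(G_T, M^T)`: the Loewner
inequality holds along every path of length `T` of `G` (i.e. every edge of `G_T`). -/
def IsQuadMultinormLift {V : Type*} {n N : ℕ} (E : Set (V × V × Fin N))
    (A : Fin N → Matrix (Fin n) (Fin n) ℝ) (T : ℕ) (γ : ℝ)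
    (Q : V → Matrix (Fin n) (Fin n) ℝ) : Prop :=
  (∀ u : V, (Q u).PosDef) ∧
    ∀ (v : Fin (T + 1) → V) (σ : Fin T → Fin N), IsPath E v σ →
      (γ ^ 2 • Q (v 0) -
        (pathProd A T σ)ᵀ * Q (v (Fin.last T)) * pathProd A T σ).PosSemidef

/-- `Q` is a path-dependent Lyapunov function with memory `T` for `S(G, M)`:
one positive definite quadratic form per path of length `T`, with a strict decrease
condition along every path of length `T + 1`. -/
def IsPathDepLyap {V : Type*} {n N : ℕ} (E : Set (V × V × Fin N))
    (A : Fin N → Matrix (Fin n) (Fin n) ℝ) (T : ℕ)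
    (Q : (Fin (T + 1) → V) → (Fin T → Fin N) → Matrix (Fin n) (Fin n) ℝ) : Prop :=
  (∀ (v : Fin (T + 1) → V) (σ : Fin T → Fin N), IsPath E v σ → (Q v σ).PosDef) ∧
    ∀ (v : Fin (T + 2) → V) (σ : Fin (T + 1) → Fin N), IsPath E v σ →
      (Q (fun i : Fin (T + 1) => v i.castSucc) (fun i : Fin T => σ i.castSucc) -
        (A (σ (Fin.last T)))ᵀ *
          Q (fun i : Fin (T + 1) => v i.succ) (fun i : Fin T => σ i.succ) *
            A (σ (Fin.last T))).PosDef

/-- The joint spectral radius of a finite set of matrices (arbitrary switching). -/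
noncomputable def jsr {n N : ℕ} (A : Fin N → Matrix (Fin n) (Fin n) ℝ) : ℝ :=
  Filter.atTop.limsup fun t : ℕ =>
    sSup { x : ℝ | ∃ σ : Fin t → Fin N,
      x = euclOpNorm (pathProd A t σ) ^ (1 / (t : ℝ)) }

/-- The joint spectral radius of the set `M^T` of all products of `T` matrices from `M`:
products of `k` matrices from `M^T` are exactly products of `k * T` matrices from `M`. -/
noncomputable def jsrPow {n N : ℕ} (A : Fin N → Matrix (Fin n) (Fin n) ℝ) (T : ℕ) : ℝ :=
  Filter.atTop.limsup fun k : ℕ =>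
    sSup { x : ℝ | ∃ σ : Fin (k * T) → Fin N,
      x = euclOpNorm (pathProd A (k * T) σ) ^ (1 / (k : ℝ)) }

/-- The optimal value `γ*(G, M)` of the semidefinite program of Corollary 4.6. -/
noncomputable def gammaStar {V : Type*} {n N : ℕ} (E : Set (V × V × Fin N))
    (A : Fin N → Matrix (Fin n) (Fin n) ℝ) : ℝ :=
  sInf {γ : ℝ | 0 < γ ∧ ∃ Q : V → Matrix (Fin n) (Fin n) ℝ,
    (∀ u : V, (Q u).PosDef) ∧ ∀ vi vj : V, ∀ σ : Fin N, (vi, vj, σ) ∈ E →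
      (γ ^ 2 • Q vi - (A σ)ᵀ * Q vj * A σ).PosDef}

/-- The optimal value `γ*(G_T, M^T)` of the semidefinite program applied to the lifted
system `S(G_T, M^T)`. -/
noncomputable def gammaStarLift {V : Type*} {n N : ℕ} (E : Set (V × V × Fin N))
    (A : Fin N → Matrix (Fin n) (Fin n) ℝ) (T : ℕ) : ℝ :=
  sInf {γ : ℝ | 0 < γ ∧ ∃ Q : V → Matrix (Fin n) (Fin n) ℝ,
    (∀ u : V, (Q u).PosDef) ∧
      ∀ (v : Fin (T + 1) → V) (σ : Fin T → Fin N), IsPath E v σ →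
        (γ ^ 2 • Q (v 0) -
          (pathProd A T σ)ᵀ * Q (v (Fin.last T)) * pathProd A T σ).PosDef}


theorem aux_pow (n : ℕ) (c : ℝ) (hc : (n:ℝ) < c) : ∃ μ : ℝ, 0 < μ ∧ (1+μ)^n < 1 + μ * c := by
  have hn : (0:ℝ) ≤ n := Nat.cast_nonneg n
  have hc0 : 0 < c := by linarith
  obtain ⟨μ, hμ, hμ1, hμ2⟩ : ∃ μ : ℝ, 0 < μ ∧ μ < 1 ∧ μ * ((n+1) * c) < c - n := by
    have hd : 0 < (n+1)*c := by positivity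
    have h1 : 0 < (c - n) / ((n+1)*c) := div_pos (by linarith) hd
    refine ⟨min ((c - n) / ((n+1)*c)) 1 / 2, by positivity, ?_, ?_⟩
    · have := min_le_right ((c - n) / ((n+1)*c)) 1
      linarith
    · rw [← lt_div_iff₀ hd]
      have := min_le_left ((c - n) / ((n+1)*c)) 1
      linarith
  refine ⟨μ, hμ, ?_⟩
  have hb : 1 + (n:ℝ) * (-μ) ≤ (1 + -μ)^n := one_add_mul_le_pow (by linarith) n
  have hp : (1+μ)^n * (1 + -μ)^n ≤ 1 := by
    rw [← mul_pow]
    exact pow_le_one₀ (by nlinarith) (by nlinarith)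
  have hP : 0 < (1+μ)^n := by positivity
  have h1 : (1+μ)^n * (1 - n*μ) ≤ 1 := le_trans (mul_le_mul_of_nonneg_left (by linarith) hP.le) hp
  have h2 : n * μ < 1 := by
    have : μ * (n+1) * c < 1 * c := by linarith
    have := lt_of_mul_lt_mul_right this hc0.le
    linarith
  have h3 : 1 < (1 + μ*c) * (1 - n*μ) := by
    have : 0 < μ * (c - n - μ * (n * c)) := by
      apply mul_pos hμ
      have : 0 < μ * c := by positivity
      linarith
    linarith
  exact lt_of_mul_lt_mul_right (lt_of_le_of_lt h1 h3) (by linarith)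

theorem aux_det {n : ℕ} (Q : Matrix (Fin n) (Fin n) ℝ) (hQ : Q.PosDef) (f p : Fin n → ℝ) (a : ℝ)
    (ha : 0 ≤ a) (hp : 0 < p ⬝ᵥ (Q *ᵥ p)) :
    Q.det * (1 + a * ((f ⬝ᵥ p)^2 / (p ⬝ᵥ (Q *ᵥ p)))) ≤ (Q + a • vecMulVec f f).det := by
  have hu : IsUnit Q.det := hQ.det_pos.ne'.isUnit
  have e : (Q + a • vecMulVec f f).det = Q.det * (1 + a * (f ⬝ᵥ (Q⁻¹ *ᵥ f))) := by
    rw [← smul_vecMulVec, vecMulVec_eq Unit, det_add_replicateCol_mul_replicateRow hu]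
    congr 1
    rw [det_unique]
    have : replicateRow Unit f * Q⁻¹ * replicateCol Unit (a • f) =
        replicateRow Unit f * replicateCol Unit (Q⁻¹ *ᵥ (a • f)) := by
      rw [Matrix.mul_assoc, replicateCol_mulVec]
    rw [this]
    simp [mulVec_smul]
  rw [e]
  gcongr
  · exact hQ.det_pos.le
  set y := Q⁻¹ *ᵥ f with hy
  have hQy : Q *ᵥ y = f := by rw [hy, mulVec_mulVec, mul_nonsing_inv _ hu, one_mulVec]
  have hs : Qᵀ = Q := by simpa using hQ.isHermitian.eq
  have hsym : y ⬝ᵥ (Q *ᵥ p) = f ⬝ᵥ p := by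
    rw [dotProduct_mulVec, ← mulVec_transpose, hs, hQy]
  have h0 := hQ.posSemidef.dotProduct_mulVec_nonneg (y - ((f ⬝ᵥ p) / (p ⬝ᵥ (Q *ᵥ p))) • p)
  simp only [star_trivial, mulVec_sub, mulVec_smul, sub_dotProduct, dotProduct_sub, hQy, hsym,
    smul_dotProduct, dotProduct_smul, smul_eq_mul] at h0
  rw [dotProduct_comm y f, dotProduct_comm p f] at h0
  field_simp at h0
  rw [div_le_iff₀ hp]
  nlinarith

theorem john {n : ℕ} (S : Set (Matrix (Fin n) (Fin n) ℝ)) (h1 : 1 ∈ S) (R : ℝ)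
    (hR : ∀ B ∈ S, ∀ x, (B *ᵥ x) ⬝ᵥ (B *ᵥ x) ≤ R * (x ⬝ᵥ x)) :
    ∃ Q : Matrix (Fin n) (Fin n) ℝ, Q.PosDef ∧
      (∀ x M, (∀ B ∈ S, (B *ᵥ x) ⬝ᵥ (B *ᵥ x) ≤ M) → x ⬝ᵥ (Q *ᵥ x) ≤ M) ∧
      (∀ B ∈ S, ∀ x, (B *ᵥ x) ⬝ᵥ (B *ᵥ x) ≤ n * (x ⬝ᵥ (Q *ᵥ x))) := by
  let C : Set (Matrix (Fin n) (Fin n) ℝ) := {Q | Q.PosSemidef ∧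
    ∀ x M, (∀ B ∈ S, (B *ᵥ x) ⬝ᵥ (B *ᵥ x) ≤ M) → x ⬝ᵥ (Q *ᵥ x) ≤ M}
  have hq : ∀ x : Fin n → ℝ, Continuous fun Q : Matrix (Fin n) (Fin n) ℝ => x ⬝ᵥ (Q *ᵥ x) := by
    intro x
    fun_prop
  have hclosed : IsClosed C := by
    have : C = {Q | Qᵀ = Q} ∩ (⋂ x : Fin n → ℝ, {Q | 0 ≤ x ⬝ᵥ (Q *ᵥ x)}) ∩
        ⋂ x : Fin n → ℝ, ⋂ M : ℝ, ⋂ _ : (∀ B ∈ S, (B *ᵥ x) ⬝ᵥ (B *ᵥ x) ≤ M),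
          {Q | x ⬝ᵥ (Q *ᵥ x) ≤ M} := by
      ext Q
      simp [C, posSemidef_iff_dotProduct_mulVec, IsHermitian]
    rw [this]
    refine (IsClosed.inter ?_ ?_).inter ?_
    · exact isClosed_eq (by fun_prop) continuous_id
    · exact isClosed_iInter fun x => isClosed_le continuous_const (hq x)
    · exact isClosed_iInter fun x => isClosed_iInter fun M => isClosed_iInter fun _ =>
        isClosed_le (hq x) continuous_const
  have hbox : IsCompact {Q : Matrix (Fin n) (Fin n) ℝ | ∀ i j, Q i j ∈ Set.Icc (-R) R} := by
    have := isCompact_univ_pi (X := fun _ : Fin n => Fin n → ℝ) (s := fun _ => Set.pi Set.univ fun _ => Set.Icc (-R) R)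
      (fun i => isCompact_univ_pi fun j => isCompact_Icc)
    have e : {Q : Matrix (Fin n) (Fin n) ℝ | ∀ i j, Q i j ∈ Set.Icc (-R) R} =
        (Set.pi Set.univ fun _ => Set.pi Set.univ fun _ => Set.Icc (-R) R :
          Set (Fin n → Fin n → ℝ)) := by
      apply Set.ext
      intro Q
      exact ⟨fun h i _ j _ => h i j, fun h i j => h i trivial j trivial⟩
    rw [e]
    exact this
  have hsub : C ⊆ {Q : Matrix (Fin n) (Fin n) ℝ | ∀ i j, Q i j ∈ Set.Icc (-R) R} := by
    rintro Q ⟨hQ, hM⟩ i j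
    have hd : ∀ i, Q i i ≤ R := by
      intro i
      have := hM (Pi.single i 1) _ (fun B hB => hR B hB _)
      simpa using this
    have hs : Q j i = Q i j := by simpa using hQ.isHermitian.apply i j
    have hp := hQ.dotProduct_mulVec_nonneg (Pi.single i 1 + Pi.single j 1)
    have hm := hQ.dotProduct_mulVec_nonneg (Pi.single i 1 - Pi.single j 1)
    simp [mulVec_add, mulVec_sub, hs] at hp hm
    have := hd i
    have := hd j
    constructor <;> linarith
  have hcomp : IsCompact C := hbox.of_isClosed_subset hclosed hsub
  have hone : (1 : Matrix (Fin n) (Fin n) ℝ) ∈ C := by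
    refine ⟨PosSemidef.one, fun x M h => ?_⟩
    simpa using h 1 h1
  obtain ⟨Q, hQC, hmax⟩ := hcomp.exists_isMaxOn ⟨1, hone⟩ (f := fun Q => Q.det)
    (Continuous.continuousOn (by fun_prop))
  have hdet : 1 ≤ Q.det := by simpa using hmax hone
  have hPD : Q.PosDef := by
    rw [hQC.1.posDef_iff_det_ne_zero]
    exact (lt_of_lt_of_le one_pos hdet).ne'
  refine ⟨Q, hPD, hQC.2, ?_⟩
  intro B hB p
  by_contra! hlt
  have hp0 : p ≠ 0 := by
    rintro rfl
    simp at hlt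
  have hqp : 0 < p ⬝ᵥ (Q *ᵥ p) := by simpa using hPD.dotProduct_mulVec_pos hp0
  set w := B *ᵥ p with hw
  set s := w ⬝ᵥ w with hs
  have hs0 : 0 < s := lt_of_le_of_lt (by positivity) hlt
  set f := Bᵀ *ᵥ w with hf
  have hfx : ∀ x, f ⬝ᵥ x = w ⬝ᵥ (B *ᵥ x) := by
    intro x
    rw [hf, mulVec_transpose, dotProduct_mulVec]
  have hfp : f ⬝ᵥ p = s := hfx p
  have hcs : ∀ x, s⁻¹ * (f ⬝ᵥ x)^2 ≤ (B *ᵥ x) ⬝ᵥ (B *ᵥ x) := by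
    intro x
    rw [hfx, inv_mul_le_iff₀ hs0]
    have := Finset.sum_mul_sq_le_sq_mul_sq Finset.univ w (B *ᵥ x)
    simpa [hs, dotProduct, pow_two] using this
  obtain ⟨μ, hμ, hlt2⟩ := aux_pow n (s / (p ⬝ᵥ (Q *ᵥ p))) (by rwa [lt_div_iff₀ hqp])
  have hquad : ∀ x, x ⬝ᵥ (((1+μ)⁻¹ • (Q + (μ * s⁻¹) • vecMulVec f f)) *ᵥ x) =
      (1+μ)⁻¹ * (x ⬝ᵥ (Q *ᵥ x) + μ * (s⁻¹ * (f ⬝ᵥ x)^2)) := by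
    intro x
    simp [smul_mulVec, add_mulVec, vecMulVec_mulVec, dotProduct_comm x f]
    ring
  have hmem : (1+μ)⁻¹ • (Q + (μ * s⁻¹) • vecMulVec f f) ∈ C := by
    refine ⟨?_, ?_⟩
    · refine PosSemidef.smul (hQC.1.add (PosSemidef.smul ?_ (by positivity))) (by positivity)
      simpa using posSemidef_vecMulVec_self_star f
    · intro x M h
      rw [hquad, inv_mul_le_iff₀ (by positivity)]
      have a1 := hQC.2 x M h
      have a2 := (hcs x).trans (h B hB)
      nlinarith
  have hle : ((1+μ)⁻¹ • (Q + (μ * s⁻¹) • vecMulVec f f)).det ≤ Q.det := hmax hmem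
  rw [det_smul, Fintype.card_fin, inv_pow, inv_mul_le_iff₀ (by positivity)] at hle
  have h2 := aux_det Q hPD f p (μ * s⁻¹) (by positivity) hqp
  rw [hfp] at h2
  have h3 : μ * s⁻¹ * (s^2 / (p ⬝ᵥ (Q *ᵥ p))) = μ * (s / (p ⬝ᵥ (Q *ᵥ p))) := by
    field_simp
  rw [h3] at h2
  have h4 := mul_lt_mul_of_pos_left hlt2 hPD.det_pos
  linarith

theorem euclOpNorm_eq {n : ℕ} (A : Matrix (Fin n) (Fin n) ℝ) :
    euclOpNorm A = ‖toEuclideanCLM (n := Fin n) (𝕜 := ℝ) A‖ := rfl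

theorem euclOpNorm_nonneg {n : ℕ} (A : Matrix (Fin n) (Fin n) ℝ) : 0 ≤ euclOpNorm A :=
  norm_nonneg _

theorem euclOpNorm_mul_le {n : ℕ} (A B : Matrix (Fin n) (Fin n) ℝ) :
    euclOpNorm (A * B) ≤ euclOpNorm A * euclOpNorm B := by
  simp only [euclOpNorm_eq, map_mul]
  exact norm_mul_le _ _

theorem euclOpNorm_one_le {n : ℕ} : euclOpNorm (1 : Matrix (Fin n) (Fin n) ℝ) ≤ 1 := by
  rw [euclOpNorm_eq, map_one]
  exact ContinuousLinearMap.norm_id_le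

theorem euclOpNorm_sq {n : ℕ} (A : Matrix (Fin n) (Fin n) ℝ) (x : Fin n → ℝ) :
    (A *ᵥ x) ⬝ᵥ (A *ᵥ x) ≤ euclOpNorm A ^ 2 * (x ⬝ᵥ x) := by
  have h := (toEuclideanCLM (n := Fin n) (𝕜 := ℝ) A).le_opNorm (WithLp.toLp 2 x)
  rw [← euclOpNorm_eq, toEuclideanCLM_toLp] at h
  have e : ∀ y : Fin n → ℝ, y ⬝ᵥ y = ‖(WithLp.toLp 2 y : EuclideanSpace ℝ (Fin n))‖ ^ 2 := by
    intro y
    rw [EuclideanSpace.real_norm_sq_eq]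
    simp [dotProduct, pow_two]
  rw [e, e, ← mul_pow]
  exact pow_le_pow_left₀ (norm_nonneg _) h 2

theorem pathProd_succ {n N : ℕ} (A : Fin N → Matrix (Fin n) (Fin n) ℝ)
    (t : ℕ) (σ : Fin (t + 1) → Fin N) :
    pathProd A (t + 1) σ = pathProd A t (fun i => σ i.succ) * A (σ 0) := by
  simp [pathProd, List.ofFn_succ]

theorem pathProd_norm_le {n N : ℕ} (A : Fin N → Matrix (Fin n) (Fin n) ℝ) (L : ℝ) (hL0 : 0 ≤ L)
    (hL : ∀ i, euclOpNorm (A i) ≤ L) (t : ℕ) (σ : Fin t → Fin N) :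
    euclOpNorm (pathProd A t σ) ≤ L ^ t := by
  induction t with
  | zero => simpa [pathProd] using euclOpNorm_one_le (n := n)
  | succ t ih =>
    rw [pathProd_succ, pow_succ]
    exact (euclOpNorm_mul_le _ _).trans
      (mul_le_mul (ih _) (hL _) (euclOpNorm_nonneg _) (by positivity))

theorem cjsr_bound {n N : ℕ} {V : Type}
    (E : Set (V × V × Fin N)) (A : Fin N → Matrix (Fin n) (Fin n) ℝ) (g : ℝ) (hg : 0 < g)
    (hg1 : g ≤ 1) (h : cjsr E A < g) :
    ∃ K : ℝ, 0 ≤ K ∧ ∀ (t : ℕ) (v : Fin (t + 1) → V) (σ : Fin t → Fin N), IsPath E v σ →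
      euclOpNorm (pathProd A t σ) ≤ K * g ^ t := by
  obtain ⟨L, hL1, hL⟩ : ∃ L : ℝ, 1 ≤ L ∧ ∀ i, euclOpNorm (A i) ≤ L := by
    obtain ⟨L, hL⟩ := (Set.finite_range fun i => euclOpNorm (A i)).bddAbove
    exact ⟨max L 1, le_max_right _ _, fun i => (hL ⟨i, rfl⟩).trans (le_max_left _ _)⟩
  have hL0 : 0 ≤ L := by linarith
  have hroot : ∀ (t : ℕ) (σ : Fin t → Fin N),
      euclOpNorm (pathProd A t σ) ^ (1 / (t : ℝ)) ≤ L := by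
    intro t σ
    rcases Nat.eq_zero_or_pos t with rfl | ht
    · simpa using hL1
    · calc euclOpNorm (pathProd A t σ) ^ (1 / (t : ℝ)) ≤ (L ^ t) ^ (1 / (t : ℝ)) :=
            Real.rpow_le_rpow (euclOpNorm_nonneg _) (pathProd_norm_le A L hL0 hL t σ)
              (by positivity)
        _ = L := by
            rw [one_div]
            exact Real.pow_rpow_inv_natCast hL0 ht.ne'
  have hbdd : IsBoundedUnder (· ≤ ·) atTop fun t : ℕ =>
      sSup { x : ℝ | ∃ (v : Fin (t + 1) → V) (σ : Fin t → Fin N),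
        IsPath E v σ ∧ x = euclOpNorm (pathProd A t σ) ^ (1 / (t : ℝ)) } := by
    refine isBoundedUnder_of ⟨L, fun t => Real.sSup_le ?_ hL0⟩
    rintro x ⟨v, σ, -, rfl⟩
    exact hroot t σ
  have hev := eventually_lt_of_limsup_lt h hbdd
  obtain ⟨T, hT⟩ := eventually_atTop.1 hev
  refine ⟨(L / g) ^ (T + 1), by positivity, fun t v σ hp => ?_⟩
  have hLg : 1 ≤ L / g := by
    rw [le_div_iff₀ hg]
    linarith
  by_cases ht : T + 1 ≤ t
  · have h1 : euclOpNorm (pathProd A t σ) ^ (1 / (t : ℝ)) ≤ g := by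
      refine le_trans ?_ (hT t (by omega)).le
      refine le_csSup ⟨L, ?_⟩ ⟨v, σ, hp, rfl⟩
      rintro x ⟨v, σ, -, rfl⟩
      exact hroot t σ
    have h2 : euclOpNorm (pathProd A t σ) ≤ g ^ t := by
      have := pow_le_pow_left₀ (Real.rpow_nonneg (euclOpNorm_nonneg _) _) h1 t
      rwa [one_div, Real.rpow_inv_natCast_pow (euclOpNorm_nonneg _) (by omega)] at this
    exact h2.trans (le_mul_of_one_le_left (by positivity) (one_le_pow₀ hLg))
  · calc euclOpNorm (pathProd A t σ) ≤ L ^ t := pathProd_norm_le A L hL0 hL t σ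
      _ = (L / g) ^ t * g ^ t := by rw [← mul_pow, div_mul_cancel₀ _ hg.ne']
      _ ≤ (L / g) ^ (T + 1) * g ^ t := by
        gcongr
        omega

/-- if `ρ̂(G, M) < 1/√n` then `S(G, M)` admits a quadratic Lyapunov multinorm. -/
theorem exists_quad_lyapunov_multinorm {n N : ℕ} (hn : 1 ≤ n) (hN : 1 ≤ N)
    {V : Type} [Fintype V] [Nonempty V]
    (E : Set (V × V × Fin N)) (A : Fin N → Matrix (Fin n) (Fin n) ℝ)
    (hconn : StronglyConnected E)
    (hρ : cjsr E A < 1 / Real.sqrt n) :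
    ∃ γ : ℝ, 0 < γ ∧ γ < 1 ∧
      ∃ Q : V → Matrix (Fin n) (Fin n) ℝ, IsQuadMultinorm E A γ Q := by
  have hn1 : (1:ℝ) ≤ Real.sqrt n := by
    rw [Real.one_le_sqrt]
    exact_mod_cast hn
  have hsn : 0 < Real.sqrt n := by linarith
  obtain ⟨g, hg, hgs⟩ := exists_between (max_lt hρ (by positivity : 0 < 1 / Real.sqrt n))
  have hg0 : 0 < g := lt_of_le_of_lt (le_max_right _ _) hg
  have hgc : cjsr E A < g := lt_of_le_of_lt (le_max_left _ _) hg
  have hγ : g * Real.sqrt n < 1 := by rwa [lt_div_iff₀ hsn] at hgs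
  have hg1 : g ≤ 1 := by nlinarith
  obtain ⟨K, hK0, hK⟩ := cjsr_bound E A g hg0 hg1 hgc
  let S : V → Set (Matrix (Fin n) (Fin n) ℝ) := fun u =>
    {B | ∃ (t : ℕ) (v : Fin (t + 1) → V) (σ : Fin t → Fin N), IsPath E v σ ∧ v 0 = u ∧
      B = (g ^ t)⁻¹ • pathProd A t σ}
  have hS1 : ∀ u, 1 ∈ S u := by
    intro u
    refine ⟨0, fun _ => u, Fin.elim0, fun i => i.elim0, rfl, ?_⟩
    simp [pathProd]
  have hSR : ∀ u, ∀ B ∈ S u, ∀ x, (B *ᵥ x) ⬝ᵥ (B *ᵥ x) ≤ K ^ 2 * (x ⬝ᵥ x) := by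
    rintro u B ⟨t, v, σ, hp, -, rfl⟩ x
    have hx : 0 ≤ x ⬝ᵥ x := Finset.sum_nonneg fun i _ => mul_self_nonneg _
    have h1 := euclOpNorm_sq (pathProd A t σ) x
    have h2 : euclOpNorm (pathProd A t σ) ^ 2 ≤ (K * g ^ t) ^ 2 :=
      pow_le_pow_left₀ (euclOpNorm_nonneg _) (hK t v σ hp) 2
    have h3 := h1.trans (mul_le_mul_of_nonneg_right h2 hx)
    have hgt : 0 < g ^ t := by positivity
    simp only [smul_mulVec, smul_dotProduct, dotProduct_smul, smul_eq_mul]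
    rw [inv_mul_le_iff₀ hgt, inv_mul_le_iff₀ hgt]
    refine h3.trans (le_of_eq ?_)
    ring
  have hcons : ∀ vi vj σ, (vi, vj, σ) ∈ E → ∀ B ∈ S vj, g⁻¹ • (B * A σ) ∈ S vi := by
    rintro vi vj s he B ⟨t, v, σ, hp, hv, rfl⟩
    refine ⟨t + 1, Fin.cons vi v, Fin.cons s σ, ?_, rfl, ?_⟩
    · intro i
      refine Fin.cases ?_ (fun i => ?_) i
      · simpa [hv] using he
      · simpa [← Fin.succ_castSucc] using hp i
    · rw [pathProd_succ]
      simp [smul_smul, pow_succ, mul_comm]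
  choose Q hQ hQ1 hQ2 using fun u => john (S u) (hS1 u) (K ^ 2) (hSR u)
  refine ⟨g * Real.sqrt n, by positivity, hγ, Q, hQ, ?_⟩
  intro vi vj σ he
  have hsym : ∀ u, (Q u)ᵀ = Q u := fun u => by simpa using (hQ u).isHermitian.eq
  refine PosSemidef.of_dotProduct_mulVec_nonneg ?_ fun x => ?_
  · simp [IsHermitian, hsym, Matrix.mul_assoc]
  · have key := hQ1 vj (A σ *ᵥ x) (g ^ 2 * (n * (x ⬝ᵥ (Q vi *ᵥ x)))) (by
      intro B hB
      have h := hQ2 vi _ (hcons vi vj σ he B hB) x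
      simp only [smul_mulVec, smul_dotProduct, dotProduct_smul, smul_eq_mul,
        ← mulVec_mulVec] at h
      rw [inv_mul_le_iff₀ hg0, inv_mul_le_iff₀ hg0] at h
      linarith)
    have e : (A σ *ᵥ x) ⬝ᵥ (Q vj *ᵥ (A σ *ᵥ x)) = x ⬝ᵥ (((A σ)ᵀ * Q vj * A σ) *ᵥ x) := by
      rw [← mulVec_mulVec, ← mulVec_mulVec, dotProduct_mulVec x, vecMul_transpose]
    rw [e] at key
    simp only [star_trivial, sub_mulVec, dotProduct_sub, smul_mulVec, dotProduct_smul, smul_eq_mul,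
      mul_pow, Real.sq_sqrt (Nat.cast_nonneg n)]
    linarith
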